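/- For every homeomorphism h : K → K, one has h(F) = F; that is, h maps the set of folding points of K onto itself. -/

import Mathlib

open Set Filter Topology Function

noncomputable section

/-- The tent map with slope `s`. -/
def tent (s : ℝ) (x : ℝ) : ℝ := min (s * x) (s * (1 - x))

/-- The ω-limit set of `c` under iteration of `f`. -/
def omegaSet (f : ℝ → ℝ) (c : ℝ) : Set ℝ :=
  {y | ∃ φ : ℕ → ℕ, StrictMono φ ∧ Tendsto (fun k => f^[φ k] c) atTop (𝓝 y)}

/-- The inverse limit space `K = lim←([0,1], T)`, as a subset of `ℕ → ℝ`. -/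
def invLim (s : ℝ) : Set (ℕ → ℝ) :=
  {x | (∀ n, x n ∈ Icc (0 : ℝ) 1) ∧ ∀ n, x n = tent s (x (n + 1))}

/-- The `n`-th coordinate projection `π_n : K → [0,1]`. -/
def proj (s : ℝ) (n : ℕ) (x : invLim s) : ℝ := (x : ℕ → ℝ) n

/-- The inverse shift homeomorphism `σ̂⁻¹(x₀,x₁,…) = (x₁,x₂,…)` as a map `K → K`. -/
def shiftInvFun (s : ℝ) (x : invLim s) : invLim s :=
  ⟨fun n => (x : ℕ → ℝ) (n + 1), fun n => x.2.1 (n + 1), fun n => x.2.2 (n + 1)⟩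

/-- The shift homeomorphism `σ̂(x₀,x₁,…) = (T x₀, x₀, x₁, …)` as a map `K → K`. -/
def shiftFwdFun (s : ℝ) (hs1 : Real.sqrt 2 < s) (hs2 : s < 2) (x : invLim s) : invLim s := by
  refine ⟨fun n => Nat.casesOn n (tent s ((x : ℕ → ℝ) 0)) (fun k => (x : ℕ → ℝ) k), ?_, ?_⟩
  · intro n
    cases n with
    | zero =>
      have hx0 := x.2.1 0
      have hs0 : 0 ≤ s := le_of_lt (lt_of_le_of_lt (Real.sqrt_nonneg 2) hs1)
      constructor
      · exact le_min (mul_nonneg hs0 hx0.1) (mul_nonneg hs0 (by linarith [hx0.2]))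
      · rcases le_total ((x : ℕ → ℝ) 0) (1 / 2) with hc | hc
        · exact le_trans (min_le_left _ _) (by nlinarith [hx0.1, hx0.2])
        · exact le_trans (min_le_right _ _) (by nlinarith [hx0.1, hx0.2])
    | succ k => exact x.2.1 k
  · intro n
    cases n with
    | zero => rfl
    | succ k => exact x.2.2 k

/-- The integer power `σ̂^b` of the shift homeomorphism : for `b ≥ 0` it is the `b`-th iterate
of `σ̂`, and for `b < 0` the `|b|`-th iterate of `σ̂⁻¹`. -/
def shiftZ (s : ℝ) (hs1 : Real.sqrt 2 < s) (hs2 : s < 2) (b : ℤ) : invLim s → invLim s :=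
  if 0 ≤ b then (shiftFwdFun s hs1 hs2)^[b.toNat] else (shiftInvFun s)^[(-b).toNat]

/-- The set `F` of folding points of `K`. -/
def foldingPts (s : ℝ) : Set (invLim s) :=
  {x | ∀ n, proj s n x ∈ omegaSet (tent s) (1 / 2)}

/-- The set `E_p` of `p`-points of `K`. -/
def pPoints (s : ℝ) (p : ℕ) : Set (invLim s) :=
  {x | ∃ n, p < n ∧ proj s n x = 1 / 2}

/-- `A` is an arc with endpoints `a` and `b`. -/
def IsArcWith {X : Type*} [TopologicalSpace X] (A : Set X) (a b : X) : Prop :=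
  ∃ f : unitInterval → X, Topology.IsEmbedding f ∧ range f = A ∧ f 0 = a ∧ f 1 = b

/-- `A` is an arc (a homeomorphic copy of `[0,1]`). -/
def IsArc {X : Type*} [TopologicalSpace X] (A : Set X) : Prop :=
  ∃ a b, IsArcWith A a b

/-- `A` is an arc with endpoints `a`, `b`, possibly degenerate (a single point when `a = b`). -/
def IsArcBtw {X : Type*} [TopologicalSpace X] (A : Set X) (a b : X) : Prop :=
  IsArcWith A a b ∨ (a = b ∧ A = {a})

/-- `A` is an arc, possibly degenerate (i.e. a single point). -/
def IsArcOrPoint {X : Type*} [TopologicalSpace X] (A : Set X) : Prop :=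
  IsArc A ∨ ∃ x, A = {x}

/-- The composant of a point `x`: the union of all proper subcontinua containing `x`. -/
def composant {X : Type*} [TopologicalSpace X] (x : X) : Set X :=
  {y | ∃ A : Set X, IsCompact A ∧ IsConnected A ∧ A ≠ univ ∧ x ∈ A ∧ y ∈ A}

/-- `g` preserves the order along composants: for every composant `C` and every continuous
bijection `φ` from `ℝ` (respectively from `[0,∞)`) onto `C`, the map `φ⁻¹ ∘ g ∘ φ` is strictly
increasing. -/
def PreservesCompOrder {X : Type*} [TopologicalSpace X] (g : X → X) : Prop :=
  ∀ x : X,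
    (∀ φ : ℝ → X, Continuous φ → Injective φ → range φ = composant x →
      ∀ t t' u u' : ℝ, g (φ t) = φ u → g (φ t') = φ u' → t < t' → u < u') ∧
    (∀ φ : {r : ℝ // (0 : ℝ) ≤ r} → X, Continuous φ → Injective φ → range φ = composant x →
      ∀ t t' u u', g (φ t) = φ u → g (φ t') = φ u' → t < t' → u < u')

/-- Two self-maps of `X` are isotopic if there is a continuous `H : X × [0,1] → X` joining them
through homeomorphisms. -/
def Isotopic {X : Type*} [TopologicalSpace X] (f g : X → X) : Prop :=
  ∃ H : X × unitInterval → X, Continuous H ∧ (∀ x, H (x, 0) = f x) ∧ (∀ x, H (x, 1) = g x) ∧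
    ∀ t : unitInterval, IsHomeomorph fun x => H (x, t)

/-- The topological limsup of a sequence of subsets. -/
def setLimsup {X : Type*} [TopologicalSpace X] (D : ℕ → Set X) : Set X :=
  {y | ∃ φ : ℕ → ℕ, StrictMono φ ∧ ∃ z : ℕ → X, (∀ k, z k ∈ D (φ k)) ∧
    Tendsto z atTop (𝓝 y)}

/-- The point `0̄ = (0,0,0,…)` of `K` (an endpoint of `K`). -/
def zeroPt (s : ℝ) (hs1 : Real.sqrt 2 < s) : invLim s := by
  refine ⟨fun _ => 0, fun n => ⟨le_refl 0, zero_le_one⟩, fun n => ?_⟩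
  have hs0 : 0 ≤ s := le_of_lt (lt_of_le_of_lt (Real.sqrt_nonneg 2) hs1)
  simp [tent]
  exact hs0

/-! ### A topological characterization of folding points -/

/-- Topological fold property. -/
def Foldy {X : Type*} [TopologicalSpace X] (x : X) : Prop :=
  ∀ U ∈ 𝓝 x, ∃ a : X, a ≠ x ∧ ∀ V ∈ 𝓝 x, ∀ W ∈ 𝓝 a, ∃ γ : ℝ → X, Continuous γ ∧
    InjOn γ (Icc (-1) 1) ∧ (∀ t ∈ Icc (-1 : ℝ) 1, γ t ∈ U) ∧ γ (-1) ∈ W ∧ γ 1 ∈ W ∧ γ 0 ∈ V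

theorem Foldy.map {X : Type*} [TopologicalSpace X] (h : X ≃ₜ X) {x : X} (hx : Foldy x) :
    Foldy (h x) := by
  intro U hU
  obtain ⟨a, hax, H⟩ := hx (h ⁻¹' U) (h.continuous.continuousAt.preimage_mem_nhds hU)
  refine ⟨h a, fun e => hax (h.injective e), fun V hV W hW => ?_⟩
  obtain ⟨γ, h1, h2, h3, h4, h5, h6⟩ :=
    H _ (h.continuous.continuousAt.preimage_mem_nhds hV) _
      (h.continuous.continuousAt.preimage_mem_nhds hW)
  exact ⟨h ∘ γ, h.continuous.comp h1, fun t ht t' ht' e => h2 ht ht' (h.injective e),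
    h3, h4, h5, h6⟩

theorem tent_continuous (s : ℝ) : Continuous (tent s) := by
  unfold tent; fun_prop

theorem tent_left {s x : ℝ} (hs : 0 ≤ s) (hx : x ≤ 1 / 2) : tent s x = s * x := by
  unfold tent; apply min_eq_left; nlinarith

theorem tent_right {s x : ℝ} (hs : 0 ≤ s) (hx : 1 / 2 ≤ x) : tent s x = s * (1 - x) := by
  unfold tent; apply min_eq_right; nlinarith

theorem tent_lip {s : ℝ} (hs : 0 ≤ s) (x y : ℝ) : |tent s x - tent s y| ≤ s * |x - y| := by
  rcases le_total x (1 / 2) with h1 | h1 <;> rcases le_total y (1 / 2) with h2 | h2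
  · rw [tent_left hs h1, tent_left hs h2, ← mul_sub, abs_mul, abs_of_nonneg hs]
  · rw [tent_left hs h1, tent_right hs h2, ← mul_sub, abs_mul, abs_of_nonneg hs]
    apply mul_le_mul_of_nonneg_left _ hs
    rw [abs_of_nonpos (show x - y ≤ 0 by linarith), abs_le]; constructor <;> linarith
  · rw [tent_right hs h1, tent_left hs h2, ← mul_sub, abs_mul, abs_of_nonneg hs]
    apply mul_le_mul_of_nonneg_left _ hs
    rw [abs_of_nonneg (show 0 ≤ x - y by linarith), abs_le]; constructor <;> linarith
  · rw [tent_right hs h1, tent_right hs h2, ← mul_sub, abs_mul, abs_of_nonneg hs,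
      show 1 - x - (1 - y) = -(x - y) by ring, abs_neg]

theorem tent_lip_iter {s : ℝ} (hs : 0 ≤ s) (hs2 : s < 2) (x y : ℝ) (k : ℕ) :
    |(tent s)^[k] x - (tent s)^[k] y| ≤ 2 ^ k * |x - y| := by
  induction k with
  | zero => simp
  | succ k ih =>
    rw [iterate_succ_apply', iterate_succ_apply']
    refine (tent_lip hs _ _).trans ?_
    rw [pow_succ]
    nlinarith [abs_nonneg ((tent s)^[k] x - (tent s)^[k] y)]

theorem tent_mem {s x : ℝ} (hs : 0 ≤ s) (hs2 : s < 2) (hx : x ∈ Icc (0 : ℝ) 1) :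
    tent s x ∈ Icc (0 : ℝ) 1 := by
  obtain ⟨h0, h1⟩ := hx
  rcases le_total x (1 / 2) with h | h
  · rw [tent_left hs h]; constructor <;> nlinarith
  · rw [tent_right hs h]; constructor <;> nlinarith

theorem tent_iter_mem {s x : ℝ} (hs : 0 ≤ s) (hs2 : s < 2) (hx : x ∈ Icc (0 : ℝ) 1) (k : ℕ) :
    (tent s)^[k] x ∈ Icc (0 : ℝ) 1 := by
  induction k with
  | zero => simpa using hx
  | succ k ih => rw [iterate_succ_apply']; exact tent_mem hs hs2 ih

theorem omega_iff (f : ℝ → ℝ) (c y : ℝ) :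
    y ∈ omegaSet f c ↔ ∀ ε > 0, ∀ N : ℕ, ∃ j ≥ N, |f^[j] c - y| < ε := by
  constructor
  · rintro ⟨φ, hφ, ht⟩ ε hε N
    rw [Metric.tendsto_atTop] at ht
    obtain ⟨M, hM⟩ := ht ε hε
    refine ⟨φ (max M N), (le_max_right M N).trans (hφ.id_le _), ?_⟩
    simpa [Real.dist_eq] using hM (max M N) (le_max_left _ _)
  · intro H
    have hc : MapClusterPt y atTop (fun k => f^[k] c) := by
      rw [mapClusterPt_iff_frequently]
      intro U hU
      obtain ⟨ε, hε, hb⟩ := Metric.mem_nhds_iff.1 hU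
      rw [frequently_atTop]
      intro N
      obtain ⟨j, hj, hd⟩ := H ε hε N
      exact ⟨j, hj, hb (by simpa [Real.dist_eq] using hd)⟩
    obtain ⟨ψ, h1, h2⟩ := MapClusterPt.tendsto_subseq hc
    exact ⟨ψ, h1, h2⟩

theorem crit_gap {s : ℝ} (hnr : (1 : ℝ) / 2 ∉ omegaSet (tent s) (1 / 2)) :
    ∃ δ > 0, ∀ j : ℕ, δ ≤ |(tent s)^[j + 1] (1 / 2) - 1 / 2| := by
  have hne : ∀ j : ℕ, (tent s)^[j + 1] (1 / 2) ≠ 1 / 2 := by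
    intro j hj
    apply hnr
    rw [omega_iff]
    intro ε hε N
    refine ⟨(j + 1) * N, by nlinarith, ?_⟩
    rw [iterate_mul, iterate_fixed hj]
    simpa using hε
  rw [omega_iff] at hnr
  push Not at hnr
  obtain ⟨ε, hε, N, hN⟩ := hnr
  have key : ∀ M : ℕ, ∃ δ > 0, ∀ j < M, δ ≤ |(tent s)^[j + 1] (1 / 2) - 1 / 2| := by
    intro M
    induction M with
    | zero => exact ⟨1, one_pos, by simp⟩
    | succ M ih =>
      obtain ⟨δ, hδ, h⟩ := ih
      refine ⟨min δ |(tent s)^[M + 1] (1 / 2) - 1 / 2|,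
        lt_min hδ (abs_pos.2 (sub_ne_zero.2 (hne M))), fun j hj => ?_⟩
      rcases Nat.lt_succ_iff_lt_or_eq.1 hj with h' | h'
      · exact (min_le_left _ _).trans (h j h')
      · subst h'; exact min_le_right _ _
  obtain ⟨δ, hδ, h⟩ := key N
  refine ⟨min δ ε, lt_min hδ hε, fun j => ?_⟩
  by_cases hj : j < N
  · exact (min_le_left _ _).trans (h j hj)
  · exact (min_le_right _ _).trans (hN (j + 1) (by omega))

theorem tent_same_side {s a b : ℝ} (hs : 0 ≤ s) (h : |a - b| < |b - 1 / 2|) :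
    |tent s a - tent s b| = s * |a - b| := by
  rw [abs_lt] at h
  rcases le_total b (1 / 2) with hb | hb
  · rw [abs_of_nonpos (show b - 1 / 2 ≤ 0 by linarith)] at h
    rw [tent_left hs (by linarith), tent_left hs hb, ← mul_sub, abs_mul, abs_of_nonneg hs]
  · rw [abs_of_nonneg (show 0 ≤ b - 1 / 2 by linarith)] at h
    rw [tent_right hs (by linarith), tent_right hs hb, ← mul_sub, abs_mul, abs_of_nonneg hs,
      show 1 - a - (1 - b) = -(a - b) by ring, abs_neg]

theorem tent_half_add {s : ℝ} (hs : 0 ≤ s) (u : ℝ) :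
    tent s (1 / 2 + u) = s / 2 - s * |u| := by
  rcases le_total u 0 with h | h
  · rw [tent_left hs (by linarith), abs_of_nonpos h]; ring
  · rw [tent_right hs (by linarith), abs_of_nonneg h]; ring

theorem iter_expand {s δ : ℝ} (hs : 1 ≤ s)
    (hδ : ∀ j : ℕ, δ ≤ |(tent s)^[j + 1] (1 / 2) - 1 / 2|) (u : ℝ) (i : ℕ)
    (hu : |u| * s ^ (i + 1) < δ) :
    |(tent s)^[i + 1] (1 / 2 + u) - (tent s)^[i + 1] (1 / 2)| = |u| * s ^ (i + 1) := by
  have hs0 : 0 ≤ s := by linarith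
  induction i with
  | zero =>
    have := tent_half_add hs0 0
    simp only [add_zero] at this
    simp only [zero_add, iterate_one, pow_one]
    rw [tent_half_add hs0 u, this]
    rw [show s / 2 - s * |u| - (s / 2 - s * |(0:ℝ)|) = -(|u| * s) by simp; ring, abs_neg, abs_of_nonneg]
    positivity
  | succ i ih =>
    have h1 : |u| * s ^ (i + 1) ≤ |u| * s ^ (i + 1 + 1) := by
      apply mul_le_mul_of_nonneg_left _ (abs_nonneg u)
      exact pow_le_pow_right₀ hs (by omega)
    have h2 := ih (by linarith)
    rw [iterate_succ_apply' _ (i + 1), iterate_succ_apply' _ (i + 1), tent_same_side hs0, h2]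
    · ring
    · rw [h2]; linarith [hδ i]

theorem coord_iter {s : ℝ} (x : invLim s) (n k : ℕ) :
    (x : ℕ → ℝ) n = (tent s)^[k] ((x : ℕ → ℝ) (n + k)) := by
  induction k with
  | zero => rfl
  | succ k ih => rw [ih, iterate_succ_apply, x.2.2 (n + k)]; rfl

theorem coord_cont {s : ℝ} (n : ℕ) : Continuous (fun x : invLim s => (x : ℕ → ℝ) n) :=
  (continuous_apply n).comp continuous_subtype_val

theorem conv_lemma {s : ℝ} (hs : 0 ≤ s) (hs2 : s < 2) (x : invLim s) (y : ℕ → invLim s)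
    (H : ∀ N, |(y N : ℕ → ℝ) N - (x : ℕ → ℝ) N| < 1 / ((N + 1) * 2 ^ N)) :
    Tendsto y atTop (𝓝 x) := by
  rw [tendsto_subtype_rng, tendsto_pi_nhds]
  intro j
  rw [tendsto_iff_dist_tendsto_zero]
  refine squeeze_zero' (Eventually.of_forall fun _ => dist_nonneg) ?_
    (tendsto_one_div_add_atTop_nhds_zero_nat (𝕜 := ℝ))
  filter_upwards [eventually_ge_atTop j] with N hN
  obtain ⟨k, rfl⟩ := Nat.exists_eq_add_of_le hN
  rw [Real.dist_eq, coord_iter (y (j + k)) j k, coord_iter x j k]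
  refine (tent_lip_iter hs hs2 _ _ k).trans ?_
  have h1 := (H (j + k)).le
  have h2 : (2 : ℝ) ^ k ≤ 2 ^ (j + k) := pow_le_pow_right₀ (by norm_num) (by omega)
  calc (2 : ℝ) ^ k * |(y (j + k) : ℕ → ℝ) (j + k) - (x : ℕ → ℝ) (j + k)|
      ≤ 2 ^ (j + k) * (1 / (((j + k : ℕ) + 1) * 2 ^ (j + k))) := by gcongr
    _ = 1 / ((j + k : ℕ) + 1) := by field_simp

theorem nhds_basis {s : ℝ} (hs : 0 ≤ s) (hs2 : s < 2) (x : invLim s) (U : Set (invLim s))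
    (hU : U ∈ 𝓝 x) : ∃ n : ℕ, ∃ ε > 0, ∀ y : invLim s,
      |(y : ℕ → ℝ) n - (x : ℕ → ℝ) n| < ε → y ∈ U := by
  by_contra! hcon
  choose y hy hyU using fun n : ℕ => hcon n (1 / ((n + 1) * 2 ^ n)) (by positivity)
  have := conv_lemma hs hs2 x y hy
  obtain ⟨N, hN⟩ := (this.eventually hU).exists
  exact hyU N hN

/-- Point of `K` with `p`-th coordinate (the clamping of) `v`, continuing by left inverse branches. -/
def mkPt (s : ℝ) (hs : 1 ≤ s) (hs2 : s < 2) (p : ℕ) (v : ℝ) : invLim s := by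
  refine ⟨fun i => (tent s)^[p - i] (max 0 (min v (s / 2)) / s ^ (i - p)), ?_, ?_⟩
  · intro i
    apply tent_iter_mem (by linarith) hs2
    have h0 : (0 : ℝ) ≤ max 0 (min v (s / 2)) := le_max_left _ _
    have h1 : max 0 (min v (s / 2)) ≤ 1 :=
      max_le (by norm_num) ((min_le_right _ _).trans (by linarith))
    have h2 : 1 ≤ s ^ (i - p) := one_le_pow₀ hs
    exact ⟨by positivity, (div_le_one (by linarith)).2 (by linarith)⟩
  · intro i
    rcases lt_or_ge i p with h | h
    · have e1 : p - i = (p - (i + 1)) + 1 := by omega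
      have e2 : i - p = 0 := by omega
      have e3 : i + 1 - p = 0 := by omega
      simp only [e1, e2, e3, iterate_succ_apply']
    · have e1 : p - i = 0 := by omega
      have e2 : p - (i + 1) = 0 := by omega
      have e3 : i + 1 - p = (i - p) + 1 := by omega
      simp only [e1, e2, e3, iterate_zero, id]
      have h0 : (0 : ℝ) ≤ max 0 (min v (s / 2)) := le_max_left _ _
      have h1 : max 0 (min v (s / 2)) ≤ s / 2 :=
        max_le (by linarith) (min_le_right _ _)
      have h2 : 1 ≤ s ^ (i - p) := one_le_pow₀ hs
      rw [tent_left (by linarith)]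
      · have : s ≠ 0 := by linarith
        rw [pow_succ]; field_simp
      · rw [div_le_iff₀ (by positivity), pow_succ]
        nlinarith

theorem mkPt_le {s : ℝ} (hs : 1 ≤ s) (hs2 : s < 2) (p : ℕ) {v : ℝ} (h0 : 0 ≤ v) (h1 : v ≤ s / 2)
    {i : ℕ} (hi : i ≤ p) : (mkPt s hs hs2 p v : ℕ → ℝ) i = (tent s)^[p - i] v := by
  have e2 : i - p = 0 := by omega
  simp [mkPt, e2, h0, h1]

theorem mkPt_cont {s : ℝ} (hs : 1 ≤ s) (hs2 : s < 2) (p : ℕ) : Continuous (mkPt s hs hs2 p) := by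
  apply Continuous.subtype_mk
  apply continuous_pi
  intro i
  exact ((tent_continuous s).iterate _).comp (by fun_prop)

theorem invLim_compact (s : ℝ) : IsCompact (invLim s) := by
  have h1 : IsCompact (Set.pi univ fun _ : ℕ => Icc (0 : ℝ) 1) :=
    isCompact_univ_pi fun _ => isCompact_Icc
  refine h1.of_isClosed_subset ?_ (fun x hx n _ => hx.1 n)
  have : invLim s = (⋂ n, {x : ℕ → ℝ | x n ∈ Icc (0 : ℝ) 1}) ∩
      ⋂ n, {x : ℕ → ℝ | x n = tent s (x (n + 1))} := by
    ext x; simp [invLim]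
  rw [this]
  refine IsClosed.inter (isClosed_iInter fun n => isClosed_Icc.preimage (continuous_apply n))
    (isClosed_iInter fun n => isClosed_eq (continuous_apply n)
      ((tent_continuous s).comp (continuous_apply _)))

theorem folding_foldy {s : ℝ} (hs : 1 < s) (hs2 : s < 2) {δ : ℝ} (hδ0 : 0 < δ)
    (hδ : ∀ j : ℕ, δ ≤ |(tent s)^[j + 1] (1 / 2) - 1 / 2|)
    (x : invLim s) (hx : x ∈ foldingPts s) : Foldy x := by
  have hs0 : 0 ≤ s := by linarith
  intro U hU
  obtain ⟨n, ε, hε, hnU⟩ := nhds_basis hs0 hs2 x U hU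
  obtain ⟨η, hη0, hη1, hη2, hη3⟩ : ∃ η > 0, η < δ ∧ η < ε / 2 ∧ η < (s - 1) / 2 := by
    refine ⟨min δ (min (ε / 2) ((s - 1) / 2)) / 2, ?_, ?_, ?_, ?_⟩
    · have : 0 < min δ (min (ε / 2) ((s - 1) / 2)) :=
        lt_min hδ0 (lt_min (by linarith) (by linarith))
      linarith
    all_goals
      have : 0 < min δ (min (ε / 2) ((s - 1) / 2)) :=
        lt_min hδ0 (lt_min (by linarith) (by linarith))
      have h1 := min_le_left δ (min (ε / 2) ((s - 1) / 2))
      have h2 := min_le_right δ (min (ε / 2) ((s - 1) / 2))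
      have h3 := min_le_left (ε / 2) ((s - 1) / 2)
      have h4 := min_le_right (ε / 2) ((s - 1) / 2)
      linarith
  -- choose positions
  have hk : ∀ N : ℕ, ∃ k ≥ n + 1, |(tent s)^[k] (1 / 2) - (x : ℕ → ℝ) N|
      < 1 / ((N + 1) * 2 ^ N) := fun N =>
    (omega_iff _ _ _).1 (hx N) _ (by positivity) (n + 1)
  choose k hk1 hk2 using hk
  -- the scale
  let c : ℕ → ℝ := fun N => η / s ^ (N + k N - n)
  let γ : ℕ → ℝ → invLim s := fun N t => mkPt s hs.le hs2 (N + k N) (1 / 2 + t * c N)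
  have hc0 : ∀ N, 0 < c N := fun N => by positivity
  have hc1 : ∀ N, c N ≤ η := fun N => div_le_self hη0.le (one_le_pow₀ hs.le)
  have hv : ∀ N, ∀ t ∈ Icc (-1 : ℝ) 1, 0 ≤ 1 / 2 + t * c N ∧ 1 / 2 + t * c N ≤ s / 2 := by
    intro N t ht
    have a1 := hc0 N
    have a2 := hc1 N
    constructor <;> nlinarith [ht.1, ht.2]
  have h0m : (0 : ℝ) ∈ Icc (-1 : ℝ) 1 := by constructor <;> norm_num
  have h1m : (1 : ℝ) ∈ Icc (-1 : ℝ) 1 := by constructor <;> norm_num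
  have hm1m : (-1 : ℝ) ∈ Icc (-1 : ℝ) 1 := by constructor <;> norm_num
  have hγ : ∀ N, ∀ t ∈ Icc (-1 : ℝ) 1, ∀ i ≤ N + k N,
      (γ N t : ℕ → ℝ) i = (tent s)^[N + k N - i] (1 / 2 + t * c N) := fun N t ht i hi =>
    mkPt_le hs.le hs2 _ (hv N t ht).1 (hv N t ht).2 hi
  have hlen : ∀ N, ∀ t ∈ Icc (-1 : ℝ) 1,
      |(γ N t : ℕ → ℝ) n - (γ N 0 : ℕ → ℝ) n| = |t| * η := by
    intro N t ht
    have hkN := hk1 N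
    obtain ⟨i, hi⟩ : ∃ i, N + k N - n = i + 1 := ⟨N + k N - n - 1, by omega⟩
    have e : |t * c N| * s ^ (i + 1) = |t| * η := by
      rw [abs_mul, abs_of_pos (hc0 N)]
      simp only [c, hi]
      field_simp
    rw [hγ N t ht n (by omega), hγ N 0 h0m n (by omega), hi, zero_mul, add_zero,
      iter_expand hs.le hδ, e]
    rw [e]
    have : |t| ≤ 1 := abs_le.2 ht
    nlinarith
  have hsym : ∀ N, ∀ i < N + k N, (γ N 1 : ℕ → ℝ) i = (γ N (-1) : ℕ → ℝ) i := by
    intro N i hi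
    obtain ⟨j, hj⟩ : ∃ j, N + k N - i = j + 1 := ⟨N + k N - i - 1, by omega⟩
    rw [hγ N 1 h1m i hi.le, hγ N (-1) hm1m i hi.le, hj, iterate_succ_apply, iterate_succ_apply,
      tent_half_add hs0, tent_half_add hs0]
    simp
  have hy : Tendsto (fun N => γ N 0) atTop (𝓝 x) := by
    apply conv_lemma hs0 hs2
    intro N
    rw [hγ N 0 h0m N (by omega)]
    simpa using hk2 N
  obtain ⟨a, haK, φ, hφ, hφt⟩ := (invLim_compact s).tendsto_subseq
    (x := fun N => (γ N 1 : ℕ → ℝ)) (fun N => (γ N 1).2)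
  have hta : Tendsto (fun N => γ (φ N) 1) atTop (𝓝 (⟨a, haK⟩ : invLim s)) :=
    tendsto_subtype_rng.2 hφt
  have htb : Tendsto (fun N => γ (φ N) (-1)) atTop (𝓝 (⟨a, haK⟩ : invLim s)) := by
    rw [tendsto_subtype_rng, tendsto_pi_nhds] at hta ⊢
    intro i
    refine (hta i).congr' ?_
    filter_upwards [eventually_ge_atTop i] with N hN
    apply hsym
    have := hφ.id_le N
    have := hk1 (φ N)
    simp only [id] at *
    omega
  have hyφ := hy.comp hφ.tendsto_atTop
  refine ⟨⟨a, haK⟩, ?_, ?_⟩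
  · intro hax
    have l1 := ((coord_cont n).tendsto _).comp hta
    have l2 := ((coord_cont n).tendsto _).comp hyφ
    have l3 := (l1.sub l2).abs
    have l4 : Tendsto (fun _ : ℕ => η) atTop (𝓝 |a n - (x : ℕ → ℝ) n|) := by
      refine l3.congr fun N => ?_
      have := hlen (φ N) 1 h1m
      simpa using this
    have l5 := tendsto_nhds_unique l4 tendsto_const_nhds
    rw [← hax] at l5
    simp at l5
    linarith
  · intro V hV W hW
    have hclose : ∀ᶠ N in atTop, |(γ (φ N) 0 : ℕ → ℝ) n - (x : ℕ → ℝ) n| < ε / 2 := by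
      have l2 := ((coord_cont n).tendsto _).comp hyφ
      have := (Metric.tendsto_nhds.1 l2) (ε / 2) (by linarith)
      simpa [Real.dist_eq] using this
    obtain ⟨N, hN1, hN2, hN3, hN4⟩ := (hclose.and ((hta.eventually hW).and
      ((htb.eventually hW).and (hyφ.eventually hV)))).exists
    refine ⟨γ (φ N), (mkPt_cont hs.le hs2 _).comp (by fun_prop), ?_, ?_, hN3, hN2, hN4⟩
    · intro t ht t' ht' e
      have e1 : (γ (φ N) t : ℕ → ℝ) (φ N + k (φ N)) = (γ (φ N) t' : ℕ → ℝ) (φ N + k (φ N)) := by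
        rw [e]
      rw [hγ _ t ht _ le_rfl, hγ _ t' ht' _ le_rfl] at e1
      simp only [Nat.sub_self, iterate_zero, id] at e1
      have := hc0 (φ N)
      exact mul_right_cancel₀ this.ne' (by linarith)
    · intro t ht
      apply hnU
      have h1 := hlen (φ N) t ht
      have h2 : |t| ≤ 1 := abs_le.2 ht
      have h3 := abs_sub_le ((γ (φ N) t : ℕ → ℝ) n) ((γ (φ N) 0 : ℕ → ℝ) n) ((x : ℕ → ℝ) n)
      nlinarith

theorem foldy_folding {s : ℝ} (hs : 1 < s)
    (x : invLim s) (hx : Foldy x) : x ∈ foldingPts s := by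
  have hs0 : 0 ≤ s := by linarith
  by_contra hnf
  simp only [foldingPts, mem_setOf_eq, not_forall, proj] at hnf
  obtain ⟨n, hn⟩ := hnf
  rw [omega_iff] at hn
  push Not at hn
  obtain ⟨ε, hε, J, hJ⟩ := hn
  let U : Set (invLim s) := {y | |(y : ℕ → ℝ) n - (x : ℕ → ℝ) n| < ε}
  have hU : U ∈ 𝓝 x := by
    apply IsOpen.mem_nhds
    · exact isOpen_lt (((coord_cont n).sub continuous_const).abs) continuous_const
    · simpa [U] using hε
  have hU2 : ∀ y ∈ U, ∀ M ≥ n + J, (y : ℕ → ℝ) M ≠ 1 / 2 := by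
    intro y hy M hM e
    have h1 := coord_iter y n (M - n)
    rw [show n + (M - n) = M by omega, e] at h1
    have h2 := hJ (M - n) (by omega)
    rw [← h1] at h2
    exact absurd hy (not_lt.2 h2)
  obtain ⟨a, hax, H⟩ := hx U hU
  apply hax
  have main : ∀ M ≥ n + J, (a : ℕ → ℝ) M = (x : ℕ → ℝ) M := by
    intro M hM
    by_contra hne
    set d := |(a : ℕ → ℝ) M - (x : ℕ → ℝ) M| with hd
    have hd0 : 0 < d := abs_pos.2 (sub_ne_zero.2 hne)
    have nb : ∀ z : invLim s, {y : invLim s | |(y : ℕ → ℝ) M - (z : ℕ → ℝ) M| < d / 3} ∈ 𝓝 z := by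
      intro z
      apply IsOpen.mem_nhds
      · exact isOpen_lt (((coord_cont M).sub continuous_const).abs) continuous_const
      · simpa using hd0
    obtain ⟨γ, h1, h2, h3, h4, h5, h6⟩ := H _ (nb x) _ (nb a)
    have hcont : ∀ i, Continuous fun t => (γ t : ℕ → ℝ) i := fun i => (coord_cont i).comp h1
    have hstep : ∀ i ≥ n + J, ∀ t ∈ Icc (-1 : ℝ) 1, ∀ t' ∈ Icc (-1 : ℝ) 1,
        (γ t : ℕ → ℝ) i = (γ t' : ℕ → ℝ) i → (γ t : ℕ → ℝ) (i + 1) = (γ t' : ℕ → ℝ) (i + 1) := by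
      intro i hi t ht t' ht' e
      have hpc : IsPreconnected ((fun t => (γ t : ℕ → ℝ) (i + 1)) '' Icc (-1 : ℝ) 1) :=
        isPreconnected_Icc.image _ (hcont _).continuousOn
      have hoc := hpc.ordConnected
      have hnot : (1 / 2 : ℝ) ∉ (fun t => (γ t : ℕ → ℝ) (i + 1)) '' Icc (-1 : ℝ) 1 := by
        rintro ⟨r, hr, hr2⟩
        exact hU2 _ (h3 r hr) (i + 1) (by omega) hr2
      have mt := mem_image_of_mem (fun t => (γ t : ℕ → ℝ) (i + 1)) ht
      have mt' := mem_image_of_mem (fun t => (γ t : ℕ → ℝ) (i + 1)) ht'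
      rw [(γ t).2.2 i, (γ t').2.2 i] at e
      have hsp : s ≠ 0 := by linarith
      rcases le_total ((γ t : ℕ → ℝ) (i + 1)) (1 / 2) with q | q <;>
        rcases le_total ((γ t' : ℕ → ℝ) (i + 1)) (1 / 2) with q' | q'
      · rw [tent_left hs0 q, tent_left hs0 q'] at e
        exact mul_left_cancel₀ hsp e
      · exact absurd (hoc.out mt mt' ⟨q, q'⟩) hnot
      · exact absurd (hoc.out mt' mt ⟨q', q⟩) hnot
      · rw [tent_right hs0 q, tent_right hs0 q'] at e
        have := mul_left_cancel₀ hsp e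
        linarith
    have hinj : InjOn (fun t => (γ t : ℕ → ℝ) M) (Icc (-1 : ℝ) 1) := by
      intro t ht t' ht' e
      apply h2 ht ht'
      have up : ∀ j, (γ t : ℕ → ℝ) (M + j) = (γ t' : ℕ → ℝ) (M + j) := by
        intro j
        induction j with
        | zero => exact e
        | succ j ih => exact hstep (M + j) (by omega) t ht t' ht' ih
      apply Subtype.ext
      funext i
      rw [coord_iter (γ t) i M, coord_iter (γ t') i M, add_comm i M, up]
    have hmono := ContinuousOn.strictMonoOn_of_injOn_Icc' (by norm_num : (-1 : ℝ) ≤ 1)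
      (hcont M).continuousOn hinj
    have h0m : (0 : ℝ) ∈ Icc (-1 : ℝ) 1 := by constructor <;> norm_num
    have h1m : (1 : ℝ) ∈ Icc (-1 : ℝ) 1 := by constructor <;> norm_num
    have hm1m : (-1 : ℝ) ∈ Icc (-1 : ℝ) 1 := by constructor <;> norm_num
    simp only [mem_setOf_eq, abs_lt] at h4 h5 h6
    have hdd : (a : ℕ → ℝ) M - (x : ℕ → ℝ) M = d ∨ (a : ℕ → ℝ) M - (x : ℕ → ℝ) M = -d := by
      rcases abs_choice ((a : ℕ → ℝ) M - (x : ℕ → ℝ) M) with q | q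
      · left; rw [hd, q]
      · right; rw [hd, q, neg_neg]
    rcases hmono with hm | hm
    · have o1 := hm hm1m h0m (by norm_num)
      have o2 := hm h0m h1m (by norm_num)
      simp only at o1 o2
      rcases hdd with q | q <;> linarith [h4.1, h4.2, h5.1, h5.2, h6.1, h6.2]
    · have o1 := hm hm1m h0m (by norm_num)
      have o2 := hm h0m h1m (by norm_num)
      simp only at o1 o2
      rcases hdd with q | q <;> linarith [h4.1, h4.2, h5.1, h5.2, h6.1, h6.2]
  apply Subtype.ext
  funext i
  rw [coord_iter a i (n + J), coord_iter x i (n + J), main _ (by omega)]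

/-- every homeomorphism of `K` maps the set of folding points onto itself. -/
theorem statement12 (s : ℝ) (hs1 : Real.sqrt 2 < s) (hs2 : s < 2)
    (hnr : (1 : ℝ) / 2 ∉ omegaSet (tent s) (1 / 2))
    (h : invLim s ≃ₜ invLim s) :
    ⇑h '' foldingPts s = foldingPts s := by
  have hs : 1 < s := by
    refine lt_trans ?_ hs1
    rw [Real.lt_sqrt] <;> norm_num
  obtain ⟨δ, hδ0, hδ⟩ := crit_gap hnr
  have key : ∀ g : invLim s ≃ₜ invLim s, ∀ x ∈ foldingPts s, g x ∈ foldingPts s :=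
    fun g x hx => foldy_folding hs _ ((folding_foldy hs hs2 hδ0 hδ x hx).map g)
  apply Subset.antisymm
  · rintro _ ⟨x, hx, rfl⟩
    exact key h x hx
  · intro y hy
    exact ⟨h.symm y, key h.symm y hy, h.apply_symm_apply y⟩
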